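/- The unbounded distortion set is G_δ: let Γ_λ be the set of lifts F of C¹ expanding circle maps (of any degree m ≥ 2) whose induced circle map preserves Lebesgue measure, equipped with the C¹ topology. Then { F ∈ Γ_λ : F has unbounded distortion, i.e. sup_{k≥1} d_k(F) = ∞ } is a G_δ subset of Γ_λ (a countable intersection of open subsets of Γ_λ). -/

import Mathlib

open Set MeasureTheory

/-- `F` is a lift of a C¹ expanding circle map of degree `m ≥ 2`. -/
def IsLiftDeg (m : ℤ) (F : ℝ → ℝ) : Prop :=
  2 ≤ m ∧ ContDiff ℝ 1 F ∧ (∀ x : ℝ, F (x + 1) = F x + m) ∧ ∀ x : ℝ, 1 < deriv F x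

/-- The circle map induced by the lift `F` preserves the Haar (Lebesgue)
probability measure on `ℝ/ℤ`. -/
def CirclePreserves (F : ℝ → ℝ) : Prop :=
  ∀ φ : AddCircle (1 : ℝ) → AddCircle (1 : ℝ),
    (∀ x : ℝ, φ x = ((F x : ℝ) : AddCircle (1 : ℝ))) →
    ∀ A : Set (AddCircle (1 : ℝ)), MeasurableSet A → volume (φ ⁻¹' A) = volume A

/-- The pair `p = (φ, ψ)` of continuous functions on `[0,1]` represents the map
`F : ℝ → ℝ`: `φ = F|_{[0,1]}` and `ψ = F'|_{[0,1]}`.  This is the injection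
giving the C¹ topology. -/
def RepresentsPair (p : C(Set.Icc (0 : ℝ) 1, ℝ) × C(Set.Icc (0 : ℝ) 1, ℝ))
    (F : ℝ → ℝ) : Prop :=
  ∀ x : Set.Icc (0 : ℝ) 1, p.1 x = F x ∧ p.2 x = deriv F x

/-- `Γ_λ`: (the C¹-embedded copy of) the set of lifts of C¹ expanding circle
maps of some degree `m ≥ 2` whose induced circle map preserves Lebesgue
measure. -/
def GammaLamSet : Set (C(Set.Icc (0 : ℝ) 1, ℝ) × C(Set.Icc (0 : ℝ) 1, ℝ)) :=
  {p | ∃ (F : ℝ → ℝ) (m : ℤ), IsLiftDeg m F ∧ CirclePreserves F ∧ RepresentsPair p F}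

/-- The lift `F` has unbounded distortion: `sup_{k ≥ 1} d_k(F) = ∞`. -/
def UnboundedDistortionLift (F : ℝ → ℝ) : Prop :=
  ∀ M : ℝ, ∃ k : ℕ, 1 ≤ k ∧ ∃ x y : ℝ,
    |F^[k] x - F^[k] y| ≤ 1 ∧
    M < Real.log (deriv (F^[k]) x) - Real.log (deriv (F^[k]) y)

open Filter Topology

namespace IsLiftDeg

variable {m : ℤ} {F : ℝ → ℝ}

theorem differentiable (h : IsLiftDeg m F) : Differentiable ℝ F :=
  h.2.1.differentiable one_ne_zero

theorem continuous_deriv (h : IsLiftDeg m F) : Continuous (deriv F) :=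
  h.2.1.continuous_deriv le_rfl

theorem map_add_intCast (h : IsLiftDeg m F) (x : ℝ) (n : ℤ) : F (x + n) = F x + n * m := by
  induction n using Int.induction_on with
  | zero => simp
  | succ n ih =>
    have := h.2.2.1 (x + n)
    push_cast at ih ⊢
    rw [← add_assoc, this, ih]
    ring
  | pred n ih =>
    have := h.2.2.1 (x + (-n - 1))
    push_cast at ih ⊢
    rw [show x + (-(n : ℝ) - 1) + 1 = x + -n by ring, ih] at this
    linarith

theorem deriv_periodic (h : IsLiftDeg m F) : Function.Periodic (deriv F) 1 := fun x => by
  rw [← deriv_comp_add_const F 1 x, funext h.2.2.1, deriv_add_const]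

theorem deriv_fract (h : IsLiftDeg m F) (x : ℝ) : deriv F (Int.fract x) = deriv F x := by
  rw [← Int.self_sub_floor, ← mul_one (⌊x⌋ : ℝ)]
  exact h.deriv_periodic.sub_int_mul_eq ⌊x⌋

theorem eq_fract (h : IsLiftDeg m F) (x : ℝ) :
    F x = F (Int.fract x) + ⌊x⌋ * (F 1 - F 0) := by
  have h1 := h.map_add_intCast (Int.fract x) ⌊x⌋
  have h2 := h.2.2.1 0
  rw [Int.fract_add_floor] at h1
  rw [zero_add] at h2
  rw [h1, h2]
  ring

theorem deriv_iterate_succ (h : IsLiftDeg m F) (k : ℕ) (x : ℝ) :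
    deriv (F^[k + 1]) x = deriv F (F^[k] x) * deriv (F^[k]) x := by
  rw [Function.iterate_succ']
  exact deriv_comp x (h.differentiable _) (h.differentiable.iterate k x)

theorem deriv_iterate_pos (h : IsLiftDeg m F) (k : ℕ) (x : ℝ) : 0 < deriv (F^[k]) x := by
  induction k with
  | zero => simp
  | succ k ih =>
    rw [h.deriv_iterate_succ]
    exact mul_pos (one_pos.trans (h.2.2.2 _)) ih

theorem strictMono_iterate (h : IsLiftDeg m F) (k : ℕ) : StrictMono (F^[k]) :=
  strictMono_of_deriv_pos (h.deriv_iterate_pos k)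

theorem continuous_deriv_iterate (h : IsLiftDeg m F) (k : ℕ) : Continuous (deriv (F^[k])) := by
  induction k with
  | zero => simpa using continuous_const
  | succ k ih =>
    simp only [funext (h.deriv_iterate_succ k)]
    exact (h.continuous_deriv.comp (h.differentiable.continuous.iterate k)).mul ih

/-- In the definition of distortion, the closed condition can be replaced by an open one. -/
theorem exists_abs_sub_lt_one (h : IsLiftDeg m F) {k : ℕ} {M x y : ℝ}
    (hxy : |F^[k] x - F^[k] y| ≤ 1)
    (hM : M < Real.log (deriv (F^[k]) x) - Real.log (deriv (F^[k]) y)) :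
    ∃ z : ℝ, |F^[k] z - F^[k] y| < 1 ∧
      M < Real.log (deriv (F^[k]) z) - Real.log (deriv (F^[k]) y) := by
  have hopen : ∀ᶠ z in 𝓝 x, M < Real.log (deriv (F^[k]) z) - Real.log (deriv (F^[k]) y) := by
    refine Tendsto.eventually_const_lt hM (Continuous.tendsto ?_ x)
    exact ((h.continuous_deriv_iterate k).log fun z => (h.deriv_iterate_pos k z).ne').sub
      continuous_const
  have hmono := h.strictMono_iterate k
  rw [abs_le] at hxy
  rcases lt_trichotomy x y with hlt | rfl | hgt
  · obtain ⟨z, hz, hxz, hzy⟩ := ((hopen.filter_mono nhdsWithin_le_nhds).and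
      (Ioo_mem_nhdsGT hlt)).exists
    refine ⟨z, abs_lt.2 ⟨?_, ?_⟩, hz⟩ <;> linarith [hmono hxz, hmono hzy]
  · exact ⟨x, by simp, hM⟩
  · obtain ⟨z, hz, hyz, hzx⟩ := ((hopen.filter_mono nhdsWithin_le_nhds).and
      (Ioo_mem_nhdsLT hgt)).exists
    refine ⟨z, abs_lt.2 ⟨?_, ?_⟩, hz⟩ <;> linarith [hmono hyz, hmono hzx]

end IsLiftDeg

theorem fract_mem_unitInterval (x : ℝ) : Int.fract x ∈ Icc (0 : ℝ) 1 :=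
  ⟨Int.fract_nonneg x, (Int.fract_lt_one x).le⟩

section Represents

variable {p q : C(Icc (0 : ℝ) 1, ℝ) × C(Icc (0 : ℝ) 1, ℝ)} {F G : ℝ → ℝ} {m n : ℤ}

theorem RepresentsPair.abs_sub_le_dist (hp : RepresentsPair p F) (hq : RepresentsPair q G)
    {x : ℝ} (hx : x ∈ Icc (0 : ℝ) 1) : |F x - G x| ≤ dist p q := by
  rw [← (hp ⟨x, hx⟩).1, ← (hq ⟨x, hx⟩).1, ← Real.dist_eq]
  exact (ContinuousMap.dist_apply_le_dist _).trans (le_max_left _ _)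

theorem RepresentsPair.abs_deriv_sub_le_dist (hp : RepresentsPair p F)
    (hq : RepresentsPair q G) (hF : IsLiftDeg m F) (hG : IsLiftDeg n G) (x : ℝ) :
    |deriv F x - deriv G x| ≤ dist p q := by
  have hx := fract_mem_unitInterval x
  rw [← hF.deriv_fract, ← hG.deriv_fract, ← (hp ⟨_, hx⟩).2, ← (hq ⟨_, hx⟩).2, ← Real.dist_eq]
  exact (ContinuousMap.dist_apply_le_dist _).trans (le_max_right _ _)

theorem RepresentsPair.abs_sub_le_mul_dist (hp : RepresentsPair p F)
    (hq : RepresentsPair q G) (hF : IsLiftDeg m F) (hG : IsLiftDeg n G) (x : ℝ) :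
    |F x - G x| ≤ (3 + 2 * |x|) * dist p q := by
  have h0 := hp.abs_sub_le_dist hq (x := 0) (by simp)
  have h1 := hp.abs_sub_le_dist hq (x := 1) (by simp)
  have hx := hp.abs_sub_le_dist hq (fract_mem_unitInterval x)
  have hfl : |(⌊x⌋ : ℝ)| ≤ |x| + 1 := by
    have := abs_sub x (Int.fract x)
    rw [Int.self_sub_fract, abs_of_nonneg (Int.fract_nonneg x)] at this
    linarith [Int.fract_lt_one x]
  have hsub : |(F 1 - G 1) - (F 0 - G 0)| ≤ 2 * dist p q := by
    linarith [abs_sub (F 1 - G 1) (F 0 - G 0)]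
  rw [hF.eq_fract, hG.eq_fract]
  calc _ = |(F (Int.fract x) - G (Int.fract x)) + ⌊x⌋ * ((F 1 - G 1) - (F 0 - G 0))| := by
        congr 1; ring
    _ ≤ |F (Int.fract x) - G (Int.fract x)| + |(⌊x⌋ : ℝ)| * |(F 1 - G 1) - (F 0 - G 0)| := by
        rw [← abs_mul]; exact abs_add_le _ _
    _ ≤ dist p q + (|x| + 1) * (2 * dist p q) := by gcongr
    _ = _ := by ring

theorem RepresentsPair.lift_unique (hp : RepresentsPair p F) (hq : RepresentsPair p G)
    (hF : IsLiftDeg m F) (hG : IsLiftDeg n G) : F = G := by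
  ext x
  have := hp.abs_sub_le_mul_dist hq hF hG x
  rw [dist_self, mul_zero] at this
  exact sub_eq_zero.1 (abs_nonpos_iff.1 this)

end Represents

namespace GammaLamSet

/-- The lift represented by a point of `GammaLamSet`. -/
noncomputable def lift (p : GammaLamSet) : ℝ → ℝ := p.2.choose

/-- The degree of the lift represented by a point of `GammaLamSet`. -/
noncomputable def degree (p : GammaLamSet) : ℤ := p.2.choose_spec.choose

theorem isLiftDeg_lift (p : GammaLamSet) : IsLiftDeg (degree p) (lift p) :=
  p.2.choose_spec.choose_spec.1

theorem representsPair_lift (p : GammaLamSet) : RepresentsPair p (lift p) :=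
  p.2.choose_spec.choose_spec.2.2

theorem continuous_lift : Continuous fun z : GammaLamSet × ℝ => lift z.1 z.2 := by
  refine continuous_iff_continuousAt.2 fun ⟨p, x⟩ => ?_
  have h : Tendsto (fun z : GammaLamSet × ℝ => lift z.1 z.2 - lift p z.2) (𝓝 (p, x)) (𝓝 0) := by
    refine squeeze_zero_norm (a := fun z => (3 + 2 * |z.2|) * dist z.1 p) (fun z => ?_) ?_
    · exact (representsPair_lift z.1).abs_sub_le_mul_dist (representsPair_lift p)
        (isLiftDeg_lift _) (isLiftDeg_lift _) _
    · exact Continuous.tendsto' (by fun_prop) _ _ (by simp)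
  have h' : Tendsto (fun z : GammaLamSet × ℝ => lift p z.2) (𝓝 (p, x)) (𝓝 (lift p x)) :=
    ((isLiftDeg_lift p).differentiable.continuous.comp continuous_snd).tendsto _
  simpa [ContinuousAt] using h.add h'

theorem continuous_deriv_lift : Continuous fun z : GammaLamSet × ℝ => deriv (lift z.1) z.2 := by
  refine continuous_iff_continuousAt.2 fun ⟨p, x⟩ => ?_
  have h : Tendsto (fun z : GammaLamSet × ℝ => deriv (lift z.1) z.2 - deriv (lift p) z.2)
      (𝓝 (p, x)) (𝓝 0) := by
    refine squeeze_zero_norm (a := fun z => dist z.1 p) (fun z => ?_) ?_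
    · exact (representsPair_lift z.1).abs_deriv_sub_le_dist (representsPair_lift p)
        (isLiftDeg_lift _) (isLiftDeg_lift _) _
    · exact Continuous.tendsto' (by fun_prop) _ _ (by simp)
  have h' : Tendsto (fun z : GammaLamSet × ℝ => deriv (lift p) z.2) (𝓝 (p, x))
      (𝓝 (deriv (lift p) x)) :=
    ((isLiftDeg_lift p).continuous_deriv.comp continuous_snd).tendsto _
  simpa [ContinuousAt] using h.add h'

theorem continuous_lift_iterate (k : ℕ) (x : ℝ) :
    Continuous fun p : GammaLamSet => (lift p)^[k] x := by
  induction k with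
  | zero => exact continuous_const
  | succ k ih =>
    simp only [Function.iterate_succ_apply']
    exact continuous_lift.comp (continuous_id.prodMk ih)

theorem continuous_deriv_lift_iterate (k : ℕ) (x : ℝ) :
    Continuous fun p : GammaLamSet => deriv ((lift p)^[k]) x := by
  induction k with
  | zero => simpa using continuous_const
  | succ k ih =>
    simp only [(isLiftDeg_lift _).deriv_iterate_succ]
    exact (continuous_deriv_lift.comp (continuous_id.prodMk (continuous_lift_iterate k x))).mul ih

theorem continuous_log_deriv_lift_iterate (k : ℕ) (x : ℝ) :
    Continuous fun p : GammaLamSet => Real.log (deriv ((lift p)^[k]) x) :=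
  (continuous_deriv_lift_iterate k x).log fun p => ((isLiftDeg_lift p).deriv_iterate_pos k x).ne'

theorem isOpen_exists_distortion_gt (M : ℝ) :
    IsOpen {p : GammaLamSet | ∃ k : ℕ, 1 ≤ k ∧ ∃ x y : ℝ,
      |(lift p)^[k] x - (lift p)^[k] y| ≤ 1 ∧
      M < Real.log (deriv ((lift p)^[k]) x) - Real.log (deriv ((lift p)^[k]) y)} := by
  refine isOpen_iff_mem_nhds.2 fun p ⟨k, hk, x, y, hxy, hM⟩ => ?_
  obtain ⟨z, hz, hzM⟩ := (isLiftDeg_lift p).exists_abs_sub_lt_one hxy hM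
  have h1 := ((continuous_lift_iterate k z).sub (continuous_lift_iterate k y)).abs.tendsto p
  have h2 := ((continuous_log_deriv_lift_iterate k z).sub
    (continuous_log_deriv_lift_iterate k y)).tendsto p
  filter_upwards [h1.eventually_lt_const hz, h2.eventually_const_lt hzM] with q hq hqM
  exact ⟨k, hk, z, y, hq.le, hqM⟩

end GammaLamSet

/-- the unbounded distortion set is `G_δ`: in `Γ_λ` with the C¹
topology, the set of elements with unbounded distortion is a `G_δ` subset. -/
theorem unbounded_distortion_Gdelta :
    IsGδ {p : ↥GammaLamSet | ∀ (F : ℝ → ℝ) (m : ℤ), IsLiftDeg m F →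
      RepresentsPair (p : C(Set.Icc (0 : ℝ) 1, ℝ) × C(Set.Icc (0 : ℝ) 1, ℝ)) F →
      UnboundedDistortionLift F} := by
  convert IsGδ.iInter_of_isOpen fun n : ℕ => GammaLamSet.isOpen_exists_distortion_gt n
  ext p
  simp only [mem_ofPred_eq, mem_iInter]
  constructor
  · intro h n
    exact h _ _ (GammaLamSet.isLiftDeg_lift p) (GammaLamSet.representsPair_lift p) n
  · intro h F m hF hp M
    obtain rfl := (GammaLamSet.representsPair_lift p).lift_unique hp
      (GammaLamSet.isLiftDeg_lift p) hF
    obtain ⟨n, hn⟩ := exists_nat_gt M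
    obtain ⟨k, hk, x, y, hxy, hM⟩ := h n
    exact ⟨k, hk, x, y, hxy, hn.trans hM⟩
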